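/- Let n ∈ {3, 4, 5}, and let eₙ (respectively fₙ) denote e₃ = (√3 − 1)/√2, e₄ = √3 − √2, e₅ = (1/2)(√15 − √5 + √3 − 3) (respectively f₃ = (√3 − 1)/√2, f₄ = √2 − 1, f₅ = (1/2)(√(10 + 2√5) − √5 − 1)). Then (1/2)(fₙ⁻¹ − fₙ)·cos(π/n) = (1/2)(eₙ⁻¹ − eₙ)·cos(π/3). -/

import Mathlib

open Real

/-- A root of `x ^ 2 + 2 * c * x = 1` satisfies `(x⁻¹ - x) / 2 = c`. -/
lemma half_inv_sub_self_eq {x c : ℝ} (h : x * (x + 2 * c) = 1) :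
    (1 / 2) * (x⁻¹ - x) = c := by
  rw [inv_eq_of_mul_eq_one_right h]
  ring

/-- The coefficient of γ_C computed in the B-projection equals the
coefficient λ_C computed in the A-projection, for n = 3, 4, 5. -/
theorem stmt_9 (n : ℕ) (hn : n = 3 ∨ n = 4 ∨ n = 5) (e f : ℝ)
    (he3 : n = 3 → e = (Real.sqrt 3 - 1) / Real.sqrt 2)
    (he4 : n = 4 → e = Real.sqrt 3 - Real.sqrt 2)
    (he5 : n = 5 → e = (1 / 2) * (Real.sqrt 15 - Real.sqrt 5 + Real.sqrt 3 - 3))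
    (hf3 : n = 3 → f = (Real.sqrt 3 - 1) / Real.sqrt 2)
    (hf4 : n = 4 → f = Real.sqrt 2 - 1)
    (hf5 : n = 5 → f = (1 / 2) * (Real.sqrt (10 + 2 * Real.sqrt 5) - Real.sqrt 5 - 1)) :
    (1 / 2) * (f⁻¹ - f) * Real.cos (Real.pi / n) =
      (1 / 2) * (e⁻¹ - e) * Real.cos (Real.pi / 3) := by
  rcases hn with rfl | rfl | rfl
  · rw [he3 rfl, hf3 rfl, Nat.cast_ofNat]
  · have h2 : √2 ^ 2 = (2 : ℝ) := Real.sq_sqrt (by norm_num)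
    have h3 : √3 ^ 2 = (3 : ℝ) := Real.sq_sqrt (by norm_num)
    have hf : (1 / 2) * (f⁻¹ - f) = 1 := half_inv_sub_self_eq (by
      rw [hf4 rfl]
      linear_combination h2)
    have he : (1 / 2) * (e⁻¹ - e) = √2 := half_inv_sub_self_eq (by
      rw [he4 rfl]
      linear_combination h3 - h2)
    rw [hf, he, Nat.cast_ofNat, Real.cos_pi_div_four, Real.cos_pi_div_three]
    ring
  · have h3 : √3 ^ 2 = (3 : ℝ) := Real.sq_sqrt (by norm_num)
    have h5 : √5 ^ 2 = (5 : ℝ) := Real.sq_sqrt (by norm_num)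
    have h15 : √15 = √3 * √5 := by
      rw [← Real.sqrt_mul (by norm_num)]
      norm_num
    have hr : √(10 + 2 * √5) ^ 2 = 10 + 2 * √5 := Real.sq_sqrt (by positivity)
    have hf : (1 / 2) * (f⁻¹ - f) = (1 + √5) / 2 := half_inv_sub_self_eq (by
      rw [hf5 rfl]
      linear_combination (1 / 4) * hr - (1 / 4) * h5)
    have he : (1 / 2) * (e⁻¹ - e) = (3 + √5) / 2 := half_inv_sub_self_eq (by
      rw [he5 rfl, h15]
      linear_combination (1 / 4) * (√5 + 1) ^ 2 * h3 + (1 / 2) * h5)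
    rw [hf, he, Nat.cast_ofNat, Real.cos_pi_div_five, Real.cos_pi_div_three]
    linear_combination (1 / 8) * h5
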